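/- Let A ∈ S_n and let {Q_k : k ∈ ℕ} be the iterates of the cyclic Jacobi (Jacobi CoM) algorithm applied to A. Suppose the set of accumulation points of {Q_k} is finite and has m elements with 1 < m < ∞. Then for every accumulation point Q_* of {Q_k}, the tensor W^* (the orthogonal transform of A by Q_*) admits a pair 1 ≤ i_* < j_* ≤ n such that d_{i_*,j_*}(W^*) = 0 and ω_{i_*,j_*}(W^*) = 0. -/

import Mathlib

open scoped BigOperators
open Matrix

/-- Orthogonal transform of a third-order tensor by a matrix `Q`:
`W i j k = ∑ p q r, A p q r * Q p i * Q q j * Q r k`. -/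
def transform (n : ℕ) (A : Fin n → Fin n → Fin n → ℝ) (Q : Matrix (Fin n) (Fin n) ℝ) :
    Fin n → Fin n → Fin n → ℝ :=
  fun i j k => ∑ p, ∑ q, ∑ r, A p q r * Q p i * Q q j * Q r k

/-- The objective `f(Q) = ∑ i, W i i i ^ 2`. -/
def fObj (n : ℕ) (A : Fin n → Fin n → Fin n → ℝ) (Q : Matrix (Fin n) (Fin n) ℝ) : ℝ :=
  ∑ i, (transform n A Q i i i) ^ 2

/-- A third-order tensor is symmetric if its entries are invariant under all permutations
of the indices (transpositions of adjacent indices suffice). -/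
def IsSymT (n : ℕ) (A : Fin n → Fin n → Fin n → ℝ) : Prop :=
  ∀ i j k : Fin n, A i j k = A j i k ∧ A i j k = A i k j

/-- The Givens rotation `G^{(i,j,θ)}`. -/
noncomputable def givens (n : ℕ) (i j : Fin n) (θ : ℝ) : Matrix (Fin n) (Fin n) ℝ :=
  Matrix.of fun k l =>
    if k = l then (if k = i ∨ k = j then Real.cos θ else 1)
    else if k = j ∧ l = i then Real.sin θ
    else if k = i ∧ l = j then -Real.sin θ
    else 0

/-- `d_{i,j}(A)`. -/
def dT (n : ℕ) (A : Fin n → Fin n → Fin n → ℝ) (i j : Fin n) : ℝ :=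
  A i i i * A i i j - A i j j * A j j j

/-- `ω_{i,j}(A)`. -/
def ωT (n : ℕ) (A : Fin n → Fin n → Fin n → ℝ) (i j : Fin n) : ℝ :=
  A i i i ^ 2 + A j j j ^ 2 - 3 * A i i j ^ 2 - 3 * A i j j ^ 2
    - 2 * A i i i * A i j j - 2 * A i i j * A j j j

/-- All pairs `(i, j)` with `i < j` listed in the cyclic-by-row order
`(1,2), (1,3), …, (1,n), (2,3), …, (n-1,n)`. -/
def pairList (n : ℕ) : List (Fin n × Fin n) :=
  (List.finRange n).flatMap fun i =>
    (List.finRange n).filterMap fun j => if i < j then some (i, j) else none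

/-- The sequence of pairs chosen by the cyclic-by-row rule: the pair used at step `k`
is the `(k mod N)`-th pair in the row order, where `N = n(n-1)/2`. -/
def CyclicPairs (n : ℕ) (pr : ℕ → Fin n × Fin n) : Prop :=
  ∀ k : ℕ, (pairList n)[k % (pairList n).length]? = some (pr k)

/-- `Q : ℕ → SO(n)` is the sequence of iterates of the cyclic Jacobi (Jacobi CoM)
algorithm applied to `A` with pair sequence `pr`: `Q 0 = I`, and
`Q (k+1) = Q k * G^{(i,j,θ)}` where `(i,j) = pr k` and `θ ∈ (−π/4, π/4]` is a global
maximum point of `θ ↦ f(Q k * G^{(i,j,θ)})`. -/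
def JacobiIterates (n : ℕ) (A : Fin n → Fin n → Fin n → ℝ)
    (pr : ℕ → Fin n × Fin n) (Q : ℕ → Matrix (Fin n) (Fin n) ℝ) : Prop :=
  Q 0 = 1 ∧
  ∀ k : ℕ, ∃ θ : ℝ, θ ∈ Set.Ioc (-(Real.pi / 4)) (Real.pi / 4) ∧
    (∀ θ' : ℝ, fObj n A (Q k * givens n (pr k).1 (pr k).2 θ') ≤
        fObj n A (Q k * givens n (pr k).1 (pr k).2 θ)) ∧
    Q (k + 1) = Q k * givens n (pr k).1 (pr k).2 θ

def triT (n : ℕ) (A : Fin n → Fin n → Fin n → ℝ) (u v w : Fin n → ℝ) : ℝ :=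
  ∑ p, ∑ q, ∑ r, A p q r * u p * v q * w r

theorem triT_lin3 (n : ℕ) (A : Fin n → Fin n → Fin n → ℝ) (u v w z : Fin n → ℝ) (x y : ℝ) :
    triT n A u v (fun p => x * w p + y * z p) = x * triT n A u v w + y * triT n A u v z := by
  simp only [triT, Finset.mul_sum, ← Finset.sum_add_distrib]
  refine Finset.sum_congr rfl fun p _ => Finset.sum_congr rfl fun q _ =>
    Finset.sum_congr rfl fun r _ => ?_
  ring

theorem triT_swap12 (n : ℕ) (A : Fin n → Fin n → Fin n → ℝ) (hA : IsSymT n A)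
    (u v w : Fin n → ℝ) : triT n A u v w = triT n A v u w := by
  unfold triT
  rw [Finset.sum_comm]
  refine Finset.sum_congr rfl fun p _ => Finset.sum_congr rfl fun q _ =>
    Finset.sum_congr rfl fun r _ => ?_
  rw [(hA p q r).1]; ring

theorem triT_swap23 (n : ℕ) (A : Fin n → Fin n → Fin n → ℝ) (hA : IsSymT n A)
    (u v w : Fin n → ℝ) : triT n A u v w = triT n A u w v := by
  unfold triT
  refine Finset.sum_congr rfl fun p _ => ?_
  rw [Finset.sum_comm]
  refine Finset.sum_congr rfl fun q _ =>
    Finset.sum_congr rfl fun r _ => ?_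
  rw [(hA p q r).2]; ring

theorem triT_cube (n : ℕ) (A : Fin n → Fin n → Fin n → ℝ) (hA : IsSymT n A)
    (u v : Fin n → ℝ) (x y : ℝ) :
    triT n A (fun p => x * u p + y * v p) (fun p => x * u p + y * v p)
      (fun p => x * u p + y * v p) =
    x ^ 3 * triT n A u u u + 3 * x ^ 2 * y * triT n A u u v + 3 * x * y ^ 2 * triT n A u v v
      + y ^ 3 * triT n A v v v := by
  set w := fun p => x * u p + y * v p with hw
  have h3 : ∀ a b, triT n A a b w = x * triT n A a b u + y * triT n A a b v :=
    fun a b => triT_lin3 n A a b u v x y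
  have e1 : ∀ a b, triT n A w a b = triT n A a b w := fun a b => by
    rw [triT_swap12 n A hA, triT_swap23 n A hA]
  have e2 : ∀ a b, triT n A a w b = triT n A a b w := fun a b => triT_swap23 n A hA a w b
  have s1 : triT n A u v u = triT n A u u v := triT_swap23 n A hA u v u
  have s2 : triT n A v u u = triT n A u u v := by rw [triT_swap12 n A hA, s1]
  have s3 : triT n A v u v = triT n A u v v := triT_swap12 n A hA v u v
  have s4 : triT n A v v u = triT n A u v v := by rw [triT_swap23 n A hA, s3]
  rw [h3, e1 w u, e1 w v, h3, h3, e1, e1, e1, e1]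
  simp only [h3, s1, s2, s3, s4]
  ring

theorem sum_split (n : ℕ) (i j : Fin n) (hij : i ≠ j) (F G : Fin n → ℝ) (X : ℝ)
    (h : ∀ l, l ≠ i → l ≠ j → F l = G l) (h2 : F i + F j = G i + G j + X) :
    ∑ l, F l = ∑ l, G l + X := by
  have : ∑ l, (F l - G l) = ∑ l ∈ {i, j}, (F l - G l) := by
    symm
    apply Finset.sum_subset (Finset.subset_univ _)
    intro l _ hl
    simp only [Finset.mem_insert, Finset.mem_singleton, not_or] at hl
    rw [h l hl.1 hl.2, sub_self]
  rw [Finset.sum_pair hij, Finset.sum_sub_distrib] at this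
  linarith

theorem col_i (n : ℕ) (Q : Matrix (Fin n) (Fin n) ℝ) (i j : Fin n) (hij : i ≠ j) (θ : ℝ)
    (p : Fin n) : (Q * givens n i j θ) p i = Real.cos θ * Q p i + Real.sin θ * Q p j := by
  rw [Matrix.mul_apply]
  have := sum_split n i j hij (fun l => Q p l * givens n i j θ l i) (fun _ => 0)
    (Real.cos θ * Q p i + Real.sin θ * Q p j) ?_ ?_
  · simpa using this
  · intro l h1 h2; simp [givens, h1, h2]
  · simp [givens, hij.symm]; ring

theorem col_j (n : ℕ) (Q : Matrix (Fin n) (Fin n) ℝ) (i j : Fin n) (hij : i ≠ j) (θ : ℝ)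
    (p : Fin n) : (Q * givens n i j θ) p j = -Real.sin θ * Q p i + Real.cos θ * Q p j := by
  rw [Matrix.mul_apply]
  have := sum_split n i j hij (fun l => Q p l * givens n i j θ l j) (fun _ => 0)
    (-Real.sin θ * Q p i + Real.cos θ * Q p j) ?_ ?_
  · simpa using this
  · intro l h1 h2; simp [givens, h1, h2]
  · simp [givens, hij]; ring

theorem col_l (n : ℕ) (Q : Matrix (Fin n) (Fin n) ℝ) (i j : Fin n) (θ : ℝ)
    (p l : Fin n) (h1 : l ≠ i) (h2 : l ≠ j) : (Q * givens n i j θ) p l = Q p l := by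
  rw [Matrix.mul_apply, Finset.sum_eq_single l]
  · simp [givens, h1, h2]
  · intro b _ hb; simp [givens, hb, h1, h2]
  · simp

theorem row_sq (n : ℕ) (Q : Matrix (Fin n) (Fin n) ℝ) (i j : Fin n) (hij : i ≠ j) (θ : ℝ)
    (p : Fin n) : ∑ l, (Q * givens n i j θ) p l ^ 2 = ∑ l, Q p l ^ 2 := by
  have := sum_split n i j hij (fun l => (Q * givens n i j θ) p l ^ 2) (fun l => Q p l ^ 2) 0 ?_ ?_
  · simpa using this
  · intro l h1 h2; simp only [col_l n Q i j θ p l h1 h2]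
  · simp only [col_i n Q i j hij, col_j n Q i j hij]
    linear_combination (Q p i ^ 2 + Q p j ^ 2) * Real.sin_sq_add_cos_sq θ

theorem transform_eq (n : ℕ) (A : Fin n → Fin n → Fin n → ℝ) (Q : Matrix (Fin n) (Fin n) ℝ)
    (i j k : Fin n) : transform n A Q i j k =
      triT n A (fun p => Q p i) (fun p => Q p j) (fun p => Q p k) := rfl

theorem fObj_givens (n : ℕ) (A : Fin n → Fin n → Fin n → ℝ) (hA : IsSymT n A)
    (Q : Matrix (Fin n) (Fin n) ℝ) (i j : Fin n) (hij : i ≠ j) (θ : ℝ) :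
    fObj n A (Q * givens n i j θ) = fObj n A Q +
      (3 / 8 * ωT n (transform n A Q) i j * (Real.cos (4 * θ) - 1)
        + 3 / 2 * dT n (transform n A Q) i j * Real.sin (4 * θ)) := by
  unfold fObj
  apply sum_split n i j hij
  · intro l h1 h2
    simp only [transform_eq, col_l n Q i j θ _ l h1 h2]
  · simp only [ωT, dT, transform_eq, col_i n Q i j hij, col_j n Q i j hij]
    rw [triT_cube n A hA, triT_cube n A hA]
    have e : 4 * θ = 2 * (2 * θ) := by ring
    have hc : Real.cos (4 * θ) - 1 = -8 * Real.sin θ ^ 2 * Real.cos θ ^ 2 := by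
      rw [e, Real.cos_two_mul, Real.cos_sq', Real.sin_two_mul]; ring
    have hs : Real.sin (4 * θ) =
        4 * Real.sin θ * Real.cos θ * (Real.cos θ ^ 2 - Real.sin θ ^ 2) := by
      rw [e, Real.sin_two_mul, Real.sin_two_mul, Real.cos_two_mul']; ring
    rw [hc, hs]
    generalize triT n A (fun p => Q p i) (fun p => Q p i) (fun p => Q p i) = a
    generalize triT n A (fun p => Q p i) (fun p => Q p i) (fun p => Q p j) = b
    generalize triT n A (fun p => Q p i) (fun p => Q p j) (fun p => Q p j) = e
    generalize triT n A (fun p => Q p j) (fun p => Q p j) (fun p => Q p j) = d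
    have h1 : Real.cos θ ^ 2 = 1 - Real.sin θ ^ 2 := Real.cos_sq' θ
    generalize Real.sin θ = s at *
    generalize Real.cos θ = c at *
    have h3 : c ^ 3 = c * (1 - s ^ 2) := by rw [← h1]; ring
    have h4 : c ^ 4 = (1 - s ^ 2) ^ 2 := by rw [← h1]; ring
    have h5 : c ^ 5 = c * (1 - s ^ 2) ^ 2 := by rw [← h1]; ring
    have h6 : c ^ 6 = (1 - s ^ 2) ^ 3 := by rw [← h1]; ring
    ring_nf
    simp only [h1, h3, h4, h5, h6]
    ring

theorem trig_key (α β t : ℝ) (ht : t ∈ Set.Icc (-(Real.pi / 4)) (Real.pi / 4))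
    (hmax : ∀ s : ℝ, α * (Real.cos (4 * s) - 1) + β * Real.sin (4 * s) ≤ 0)
    (h0 : α * (Real.cos (4 * t) - 1) + β * Real.sin (4 * t) = 0) :
    t = 0 ∨ (α = 0 ∧ β = 0) := by
  have hβ : β = 0 := by
    have hd : HasDerivAt (fun s : ℝ => α * (Real.cos (4 * s) - 1) + β * Real.sin (4 * s))
        (α * (-Real.sin (4 * 0) * (4 * 1)) + β * (Real.cos (4 * 0) * (4 * 1))) 0 := by
      have h4 : HasDerivAt (fun s : ℝ => 4 * s) (4 * 1) 0 := (hasDerivAt_id 0).const_mul 4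
      exact ((h4.cos.sub_const 1).const_mul α).add (h4.sin.const_mul β)
    have hl : IsLocalMax (fun s : ℝ => α * (Real.cos (4 * s) - 1) + β * Real.sin (4 * s)) 0 :=
      Filter.Eventually.of_forall fun s => by simpa using hmax s
    have := hl.hasDerivAt_eq_zero hd
    simpa using this
  subst hβ
  rcases eq_or_ne α 0 with h | h
  · exact Or.inr ⟨h, rfl⟩
  · left
    have hc : Real.cos (4 * t) = 1 := by
      have : α * (Real.cos (4 * t) - 1) = 0 := by simpa using h0
      rcases mul_eq_zero.1 this with h' | h'
      · exact absurd h' h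
      · linarith
    have hp := Real.pi_pos
    have := (Real.cos_eq_one_iff_of_lt_of_lt (x := 4 * t) (by linarith [ht.1])
      (by linarith [ht.2])).1 hc
    linarith

theorem fObj_cont (n : ℕ) (A : Fin n → Fin n → Fin n → ℝ) : Continuous (fObj n A) := by
  unfold fObj transform
  fun_prop

theorem givens_cont (n : ℕ) (i j : Fin n) : Continuous (givens n i j) := by
  refine continuous_matrix fun k l => ?_
  simp only [givens, Matrix.of_apply]
  split_ifs <;> fun_prop

theorem givens_zero (n : ℕ) (i j : Fin n) : givens n i j 0 = 1 := by
  ext k l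
  simp only [givens, Matrix.of_apply, Matrix.one_apply]
  split_ifs <;> simp_all

theorem pr_lt (n : ℕ) (pr : ℕ → Fin n × Fin n) (hpr : CyclicPairs n pr) (k : ℕ) :
    (pr k).1 < (pr k).2 := by
  have h := List.mem_of_getElem? (hpr k)
  simp only [pairList, List.mem_flatMap, List.mem_filterMap] at h
  obtain ⟨i, _, j, _, h⟩ := h
  split_ifs at h with hij
  simp only [Option.some.injEq] at h
  rw [← h]; exact hij

def boxK (n : ℕ) : Set (Matrix (Fin n) (Fin n) ℝ) :=
  Set.pi Set.univ fun _ => Set.pi Set.univ fun _ => Set.Icc (-1) 1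

theorem boxK_compact (n : ℕ) : IsCompact (boxK n) :=
  isCompact_univ_pi fun _ => isCompact_univ_pi fun _ => isCompact_Icc

theorem iter_mem (n : ℕ) (A : Fin n → Fin n → Fin n → ℝ)
    (pr : ℕ → Fin n × Fin n) (hpr : CyclicPairs n pr)
    (Q : ℕ → Matrix (Fin n) (Fin n) ℝ) (hQ : JacobiIterates n A pr Q) (k : ℕ) :
    Q k ∈ boxK n := by
  have h : ∀ p, ∑ l, Q k p l ^ 2 = 1 := by
    induction k with
    | zero => intro p; simp [hQ.1, Matrix.one_apply]
    | succ k ih =>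
      intro p
      obtain ⟨θ, _, _, h⟩ := hQ.2 k
      rw [h, row_sq n _ _ _ (pr_lt n pr hpr k).ne, ih]
  intro p _ l _
  have h2 : Q k p l ^ 2 ≤ 1 := by
    rw [← h p]
    exact Finset.single_le_sum (f := fun l => Q k p l ^ 2) (fun _ _ => sq_nonneg _)
      (Finset.mem_univ l)
  exact abs_le.1 ((sq_le_one_iff_abs_le_one _).1 h2)

theorem limit_key (n : ℕ) (A : Fin n → Fin n → Fin n → ℝ) (hA : IsSymT n A)
    (pr : ℕ → Fin n × Fin n) (hpr : CyclicPairs n pr)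
    (Q : ℕ → Matrix (Fin n) (Fin n) ℝ) (hQ : JacobiIterates n A pr Q)
    (U : Ultrafilter ℕ) (hU : (U : Filter ℕ) ≤ Filter.atTop)
    (P : Matrix (Fin n) (Fin n) ℝ) (hP : Filter.Tendsto Q U (nhds P))
    (hnd : ¬ ∃ i j : Fin n, i < j ∧
        dT n (transform n A P) i j = 0 ∧ ωT n (transform n A P) i j = 0) :
    Filter.Tendsto (fun k => Q (k + 1)) U (nhds P) := by
  choose θ hθ hmax hstep using hQ.2
  have hmono : Monotone fun k => fObj n A (Q k) := by
    refine monotone_nat_of_le_succ fun k => ?_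
    have := hmax k 0
    rw [givens_zero, mul_one, ← hstep k] at this
    exact this
  have hbdd : BddAbove (Set.range fun k => fObj n A (Q k)) := by
    refine ((boxK_compact n).bddAbove_image (fObj_cont n A).continuousOn).mono ?_
    rintro _ ⟨k, rfl⟩
    exact ⟨Q k, iter_mem n A pr hpr Q hQ k, rfl⟩
  have hL := tendsto_atTop_ciSup hmono hbdd
  set L := ⨆ k, fObj n A (Q k)
  have hL1 := ((Filter.tendsto_add_atTop_iff_nat 1).2 hL).mono_left hU
  have hfP : fObj n A P = L :=
    tendsto_nhds_unique (((fObj_cont n A).tendsto P).comp hP) (hL.mono_left hU)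
  obtain ⟨t, ht, hUt⟩ := (isCompact_Icc (a := -(Real.pi / 4)) (b := Real.pi / 4)).ultrafilter_le_nhds
    (U.map θ) (by
      rw [Filter.le_principal_iff]
      exact Filter.mem_map.2 (Filter.Eventually.of_forall fun k => ⟨(hθ k).1.le, (hθ k).2⟩))
  have hθt : Filter.Tendsto θ U (nhds t) := hUt
  obtain ⟨q, -, hq⟩ := (Ultrafilter.eventually_exists_mem_iff (f := U)
    (P := fun (q : Fin n × Fin n) k => pr k = q) (Set.finite_univ)).1
    (Filter.Eventually.of_forall fun k => ⟨pr k, Set.mem_univ _, rfl⟩)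
  have hlt : q.1 < q.2 := by
    obtain ⟨k, hk⟩ := hq.exists
    rw [← hk]; exact pr_lt n pr hpr k
  have hlim : Filter.Tendsto (fun k => Q (k + 1)) U (nhds (P * givens n q.1 q.2 t)) := by
    have h1 : Filter.Tendsto (fun k => Q k * givens n q.1 q.2 (θ k)) U
        (nhds (P * givens n q.1 q.2 t)) :=
      hP.mul (((givens_cont n q.1 q.2).tendsto t).comp hθt)
    refine h1.congr' ?_
    filter_upwards [hq] with k hk
    rw [hstep k, hk]
  have hfG : fObj n A (P * givens n q.1 q.2 t) = L :=
    tendsto_nhds_unique (((fObj_cont n A).tendsto _).comp hlim) hL1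
  have hmaxP : ∀ s, fObj n A (P * givens n q.1 q.2 s) ≤ fObj n A P := by
    intro s
    rw [hfP]
    have h1 : Filter.Tendsto (fun k => fObj n A (Q k * givens n q.1 q.2 s)) U
        (nhds (fObj n A (P * givens n q.1 q.2 s))) :=
      ((fObj_cont n A).tendsto _).comp (hP.mul tendsto_const_nhds)
    refine le_of_tendsto_of_tendsto h1 hL1 ?_
    filter_upwards [hq] with k hk
    have := hmax k s
    rw [← hstep k, hk] at this
    exact this
  have key := trig_key (3 / 8 * ωT n (transform n A P) q.1 q.2)
    (3 / 2 * dT n (transform n A P) q.1 q.2) t ht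
    (fun s => by
      have := hmaxP s
      rw [fObj_givens n A hA P _ _ hlt.ne] at this
      linarith)
    (by
      have := hfG
      rw [fObj_givens n A hA P _ _ hlt.ne] at this
      linarith)
  rcases key with h0 | ⟨h1, h2⟩
  · rw [h0, givens_zero, mul_one] at hlim
    exact hlim
  · exact absurd ⟨q.1, q.2, hlt, by linarith, by linarith⟩ hnd

/-- Proposition 6.4(i) / `theorem-local-convergence-CoM`.
Suppose the set of accumulation points of the cyclic Jacobi iterates `{Q_k}` is finite
with `m` elements, `1 < m < ∞`. Then for every accumulation point `Q_*`, the tensor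
`W^* = A·(Q_*,Q_*,Q_*)` admits a pair `i_* < j_*` with `d_{i_*,j_*}(W^*) = 0` and
`ω_{i_*,j_*}(W^*) = 0`. -/
theorem stmt_17 (n : ℕ) (hn : 2 ≤ n) (A : Fin n → Fin n → Fin n → ℝ) (hA : IsSymT n A)
    (pr : ℕ → Fin n × Fin n) (hpr : CyclicPairs n pr)
    (Q : ℕ → Matrix (Fin n) (Fin n) ℝ) (hQ : JacobiIterates n A pr Q)
    (m : ℕ) (hm : 1 < m)
    (hfin : {x : Matrix (Fin n) (Fin n) ℝ | MapClusterPt x Filter.atTop Q}.Finite)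
    (hcard : {x : Matrix (Fin n) (Fin n) ℝ | MapClusterPt x Filter.atTop Q}.ncard = m) :
    ∀ Qstar : Matrix (Fin n) (Fin n) ℝ, MapClusterPt Qstar Filter.atTop Q →
      ∃ i j : Fin n, i < j ∧
        dT n (transform n A Qstar) i j = 0 ∧ ωT n (transform n A Qstar) i j = 0 := by
  intro P hP
  by_contra hnd
  set S := {x : Matrix (Fin n) (Fin n) ℝ | MapClusterPt x Filter.atTop Q} with hS
  have hopen : (S \ {P})ᶜ ∈ nhds P :=
    (hfin.subset Set.sdiff_subset).isClosed.isOpen_compl.mem_nhds (by simp)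
  obtain ⟨V, hV, hVc, hVs⟩ := exists_mem_nhds_isClosed_subset hopen
  have honly : ∀ x, MapClusterPt x Filter.atTop Q → x ∈ V → x = P := by
    intro x hx hxV
    by_contra hne
    exact hVs hxV ⟨hx, hne⟩
  have hstay : ∀ᶠ k in Filter.atTop, Q k ∈ V → Q (k + 1) ∈ V := by
    by_contra hcon
    have hfr : ∃ᶠ k in Filter.atTop, k ∈ {k | Q k ∈ V ∧ Q (k + 1) ∉ V} := by
      refine (Filter.not_eventually.1 hcon).mono fun k hk => ?_
      simpa using hk
    have hne := Filter.frequently_mem_iff_neBot.1 hfr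
    have hle := Ultrafilter.of_le (Filter.atTop ⊓ Filter.principal {k | Q k ∈ V ∧ Q (k + 1) ∉ V})
    set U := Ultrafilter.of (Filter.atTop ⊓ Filter.principal {k | Q k ∈ V ∧ Q (k + 1) ∉ V})
    have hU1 : (U : Filter ℕ) ≤ Filter.atTop := hle.trans inf_le_left
    have hU2 : ∀ᶠ k in (U : Filter ℕ), Q k ∈ V ∧ Q (k + 1) ∉ V :=
      Filter.le_principal_iff.1 (hle.trans inf_le_right)
    obtain ⟨x, -, hx⟩ := (boxK_compact n).ultrafilter_le_nhds (U.map Q) (by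
      rw [Filter.le_principal_iff]
      exact Filter.mem_map.2 (Filter.Eventually.of_forall fun k => iter_mem n A pr hpr Q hQ k))
    have hx' : Filter.Tendsto Q U (nhds x) := hx
    have hxV : x ∈ V := hVc.mem_of_tendsto hx' (hU2.mono fun k hk => hk.1)
    have hxc : MapClusterPt x Filter.atTop Q := hx'.mapClusterPt.mono hU1
    have hxP := honly x hxc hxV
    subst hxP
    have hlim := limit_key n A hA pr hpr Q hQ U hU1 x hx' hnd
    obtain ⟨k, hk1, hk2⟩ := ((hlim.eventually_mem hV).and hU2).exists
    exact hk2.2 hk1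
  have hev : ∀ᶠ k in Filter.atTop, Q k ∈ V := by
    obtain ⟨N, hN⟩ := Filter.eventually_atTop.1 hstay
    obtain ⟨M, hM, hMV⟩ := (Filter.frequently_atTop.1 (hP.frequently hV)) N
    refine Filter.eventually_atTop.2 ⟨M, fun k hk => ?_⟩
    induction k, hk using Nat.le_induction with
    | base => exact hMV
    | succ k hk ih => exact hN k (hM.trans hk) ih
  have hsub : S ⊆ {P} := by
    intro x hx
    refine honly x hx ?_
    have : ClusterPt x (Filter.principal V) := ClusterPt.mono hx (by
      rw [Filter.le_principal_iff]; exact hev)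
    exact hVc.closure_eq ▸ mem_closure_iff_clusterPt.2 this
  have := Set.ncard_le_ncard hsub (Set.finite_singleton P)
  rw [Set.ncard_singleton] at this
  omega
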